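/- arXiv:1502.06511 — 2 statements merged into one kernel-verified Lean document; each statement's English description precedes it below -/
import Mathlib

section
/- For u supported in the unit ball with |u| ≤ 1 and u_t = u ∗ γ_{n,t}, the H^{1/2} norm of the Gaussian mollification is controlled by the heat-flow energy: ‖u_ε‖²_{H^{1/2}} ≤ C ∫_ε^∞ ∫_{ℝⁿ} |∂_t u_t|² dx dt for a dimensional constant C. -/
open MeasureTheory Set Real

/-- Standard Gaussian density on `ℝⁿ`. -/
noncomputable def gaussian (n : ℕ) (x : EuclideanSpace ℝ (Fin n)) : ℝ :=
  (2 * π) ^ (-(n : ℝ) / 2) * exp (-‖x‖ ^ 2 / 2)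

/-- Rescaled Gaussian `γ_{n,t}(x) = t^{-n} γ_n(x/t)`. -/
noncomputable def gaussianScaled (n : ℕ) (t : ℝ) (x : EuclideanSpace ℝ (Fin n)) : ℝ :=
  t ^ (-(n : ℝ)) * gaussian n (t⁻¹ • x)

/-- Gaussian mollification `u_t = u ∗ γ_{n,t}`. -/
noncomputable def mollify {n : ℕ} (u : EuclideanSpace ℝ (Fin n) → ℝ) (t : ℝ)
    (x : EuclideanSpace ℝ (Fin n)) : ℝ :=
  ∫ y, u (x - y) * gaussianScaled n t y

/-- The squared `H^{1/2}` norm `∫∫ |v(x)-v(y)|²/|x-y|^{n+1} dx dy` (in `[0,∞]`). -/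
noncomputable def H12 {n : ℕ} (v : EuclideanSpace ℝ (Fin n) → ℝ) : ENNReal :=
  ∫⁻ x, ∫⁻ y, ENNReal.ofReal (|v x - v y| ^ 2 / ‖x - y‖ ^ (n + 1))

open scoped FourierTransform SchwartzMap ENNReal InnerProductSpace

theorem lintegral_enorm_fourier_sq {V : Type*} [NormedAddCommGroup V] [InnerProductSpace ℝ V]
    [FiniteDimensional ℝ V] [MeasurableSpace V] [BorelSpace V] {f : V → ℂ}
    (hf : Integrable f) (hf2 : MemLp f 2) :
    ∫⁻ w, ‖𝓕 f w‖ₑ ^ 2 = ∫⁻ x, ‖f x‖ₑ ^ 2 := by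
  set F : Lp ℂ 2 (volume : Measure V) := hf2.toLp f with hF
  have hcont : Continuous (𝓕 f) :=
    VectorFourier.fourierIntegral_continuous Real.continuous_fourierChar
      (by exact continuous_inner) hf
  have key : (𝓕 F : Lp ℂ 2 (volume : Measure V)) =ᵐ[volume] 𝓕 f := by
    apply ae_eq_of_integral_contDiff_smul_eq
    · exact (Lp.memLp (𝓕 F)).locallyIntegrable (by norm_num)
    · exact hcont.locallyIntegrable
    intro g hg hgc
    have hgc' : HasCompactSupport (fun x => (g x : ℂ)) := hgc.comp_left Complex.ofReal_zero
    set φ : 𝓢(V, ℂ) := hgc'.toSchwartzMap (Complex.ofRealCLM.contDiff.comp hg) with hφ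
    have hφg : ∀ x, φ x = (g x : ℂ) := fun x => rfl
    have h1 := congrArg (fun T => T φ) (Lp.fourier_toTemperedDistribution_eq F)
    simp only [TemperedDistribution.fourier_apply, Lp.toTemperedDistribution_apply] at h1
    calc ∫ x, g x • (𝓕 F : Lp ℂ 2 (volume : Measure V)) x
        = ∫ x, φ x • (𝓕 F : Lp ℂ 2 (volume : Measure V)) x := by simp [hφg]
      _ = ∫ x, (𝓕 φ) x • F x := h1.symm
      _ = ∫ x, (𝓕 (φ : V → ℂ)) x • f x := by
          apply integral_congr_ae
          filter_upwards [hf2.coeFn_toLp] with x hx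
          rw [hF, hx, SchwartzMap.fourier_coe]
      _ = ∫ x, φ x • 𝓕 f x :=
          VectorFourier.integral_fourierIntegral_smul_eq_flip (L := innerₗ V)
            Real.continuous_fourierChar continuous_inner φ.integrable hf |>.trans (by
              rw [flip_innerₗ]; rfl)
      _ = ∫ x, g x • 𝓕 f x := by simp [hφg]
  have h2 : eLpNorm (𝓕 f) 2 volume = eLpNorm f 2 volume := by
    rw [← eLpNorm_congr_ae key, ← eLpNorm_congr_ae hf2.coeFn_toLp, ← Lp.enorm_def, ← Lp.enorm_def,
      enorm_eq_iff_norm_eq, Lp.norm_fourier_eq]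
  have h3 (g : V → ℂ) : eLpNorm g 2 volume ^ (2 : ℝ) = ∫⁻ x, ‖g x‖ₑ ^ 2 := by
    simpa using eLpNorm_nnreal_pow_eq_lintegral (f := g) (μ := volume) (p := 2) (by norm_num)
  rw [← h3, ← h3, h2]

theorem lintegral_enorm_fourierInv_sq {V : Type*} [NormedAddCommGroup V] [InnerProductSpace ℝ V]
    [FiniteDimensional ℝ V] [MeasurableSpace V] [BorelSpace V] {f : V → ℂ}
    (hf : Integrable f) (hf2 : MemLp f 2) :
    ∫⁻ w, ‖𝓕⁻ f w‖ₑ ^ 2 = ∫⁻ x, ‖f x‖ₑ ^ 2 := by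
  rw [← lintegral_enorm_fourier_sq hf hf2]
  simp_rw [fourierInv_eq_fourier_neg]
  exact lintegral_neg_eq_self (fun w => ‖𝓕 f w‖ₑ ^ 2)

theorem gaussianScaled_eq {n : ℕ} {t : ℝ} (ht : 0 < t) (z : EuclideanSpace ℝ (Fin n)) :
    gaussianScaled n t z
      = (2 * π * t ^ 2) ^ (-(n : ℝ) / 2) * exp (-‖z‖ ^ 2 / (2 * t ^ 2)) := by
  have h : (t ^ 2) ^ (-(n : ℝ) / 2) = t ^ (-(n : ℝ)) := by
    rw [← Real.rpow_natCast, ← Real.rpow_mul ht.le]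
    congr 1
    push_cast
    ring
  rw [gaussianScaled, gaussian, Real.mul_rpow (x := 2 * π) (by positivity) (by positivity), h, norm_smul,
    norm_inv, Real.norm_of_nonneg ht.le, mul_pow]
  have : -((t⁻¹) ^ 2 * ‖z‖ ^ 2) / 2 = -‖z‖ ^ 2 / (2 * t ^ 2) := by field_simp
  rw [this]
  ring

theorem ofReal_mollify_eq_fourierInv {n : ℕ} {u : EuclideanSpace ℝ (Fin n) → ℝ} (hu : Integrable u)
    {t : ℝ} (ht : 0 < t) (x : EuclideanSpace ℝ (Fin n)) :
    (mollify u t x : ℂ) =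
      𝓕⁻ (fun w => 𝓕 (fun y => (u y : ℂ)) w * (exp (-(2 * π ^ 2 * t ^ 2) * ‖w‖ ^ 2) : ℝ)) x := by
  set b : ℂ := ((2 * π ^ 2 * t ^ 2 : ℝ) : ℂ) with hb
  have hb0 : 0 < b.re := by rw [hb, Complex.ofReal_re]; positivity
  have J : Integrable (fun w : EuclideanSpace ℝ (Fin n) ↦
      Complex.exp (-b * ‖w‖ ^ 2 + 2 * π * Complex.I * ⟪x, w⟫_ℝ)) :=
    GaussianFourier.integrable_cexp_neg_mul_sq_norm_add hb0 _ _
  have K : ∀ w, 𝓕 (fun w : EuclideanSpace ℝ (Fin n) ↦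
      Complex.exp (-b * ‖w‖ ^ 2 + 2 * π * Complex.I * ⟪x, w⟫_ℝ)) w
        = (gaussianScaled n t (x - w) : ℂ) := by
    intro w
    rw [fourier_gaussian_innerProductSpace' hb0, gaussianScaled_eq ht]
    have e1 : (π / b : ℂ) = (((2 * π * t ^ 2)⁻¹ : ℝ) : ℂ) := by
      have := pi_ne_zero
      rw [hb, ← Complex.ofReal_div]
      congr 1
      field_simp
    have e2 : (2 * π * t ^ 2) ^ (-(n : ℝ) / 2) = ((2 * π * t ^ 2)⁻¹) ^ ((n : ℝ) / 2) := by
      rw [Real.inv_rpow (by positivity), ← Real.rpow_neg (by positivity), neg_div]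
    rw [e1, e2, Complex.ofReal_mul, Complex.ofReal_cpow (by positivity), Complex.ofReal_exp]
    congr 1
    · simp
    · congr 1
      have : (t : ℂ) ≠ 0 := by exact_mod_cast ht.ne'
      have : (π : ℂ) ≠ 0 := by exact_mod_cast pi_ne_zero
      rw [hb]
      push_cast
      field_simp
  have hu' : Integrable (fun y => (u y : ℂ)) := hu.ofReal
  have S := VectorFourier.integral_fourierIntegral_smul_eq_flip
      (L := innerₗ (EuclideanSpace ℝ (Fin n)))
      Real.continuous_fourierChar continuous_inner J hu'
  rw [flip_innerₗ] at S
  calc (mollify u t x : ℂ)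
      = ((∫ y, u y * gaussianScaled n t (x - y) : ℝ) : ℂ) := by
        rw [mollify, ← integral_sub_left_eq_self _ volume x]
        simp
    _ = ∫ y, (gaussianScaled n t (x - y) : ℂ) • (u y : ℂ) := by
        rw [← integral_complex_ofReal]
        simp [mul_comm]
    _ = ∫ w, Complex.exp (-b * ‖w‖ ^ 2 + 2 * π * Complex.I * ⟪x, w⟫_ℝ) •
          𝓕 (fun y => (u y : ℂ)) w := by
        simp_rw [← K]
        exact S
    _ = _ := by
        rw [fourierInv_eq']
        congr 1
        ext w
        rw [hb, Complex.exp_add, real_inner_comm]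
        push_cast
        simp only [smul_eq_mul]
        have : (2 * π * Complex.I * ⟪w, x⟫_ℝ : ℂ) = 2 * π * ⟪w, x⟫_ℝ * Complex.I := by ring
        rw [this]
        ring

theorem integrable_and_memLp_two_of_norm_le_gaussian {V : Type*} [NormedAddCommGroup V]
    [InnerProductSpace ℝ V] [FiniteDimensional ℝ V] [MeasurableSpace V] [BorelSpace V]
    {f : V → ℂ} (hf : Continuous f) {K c : ℝ} (hc : 0 < c)
    (hb : ∀ w, ‖f w‖ ≤ K * exp (-c * ‖w‖ ^ 2)) : Integrable f ∧ MemLp f 2 := by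
  have hg : ∀ c : ℝ, 0 < c → Integrable (fun w : V => exp (-c * ‖w‖ ^ 2)) := by
    intro c hc
    have := (GaussianFourier.integrable_cexp_neg_mul_sq_norm_add (V := V) (b := (c : ℂ))
      (by simpa) 0 0).norm
    refine this.congr (Filter.Eventually.of_forall fun w => ?_)
    simp only [Complex.norm_exp]
    congr 1
    rw [inner_zero_left, Complex.ofReal_zero, mul_zero, add_zero, ← Complex.ofReal_pow,
      ← Complex.ofReal_neg, ← Complex.ofReal_mul, Complex.ofReal_re]
  refine ⟨((hg c hc).const_mul K).mono' hf.aestronglyMeasurable (.of_forall hb), ?_⟩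
  rw [memLp_two_iff_integrable_sq_norm hf.aestronglyMeasurable]
  refine ((hg (2 * c) (by positivity)).const_mul (K ^ 2)).mono'
    (by fun_prop) (.of_forall fun w => ?_)
  rw [Real.norm_of_nonneg (by positivity)]
  calc ‖f w‖ ^ 2 ≤ (K * exp (-c * ‖w‖ ^ 2)) ^ 2 := by gcongr; exact hb w
    _ = K ^ 2 * exp (-(2 * c) * ‖w‖ ^ 2) := by
      rw [mul_pow, ← Real.exp_nat_mul]; congr 2; push_cast; ring

theorem heat_symbol_le {s t r : ℝ} (ht : 0 < t) (h1 : t / 2 ≤ s) (h2 : s ≤ 3 * t / 2) :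
    4 * π ^ 2 * s * r ^ 2 * exp (-(2 * π ^ 2 * s ^ 2) * r ^ 2)
      ≤ 24 / t * exp (-(π ^ 2 * t ^ 2 / 4) * r ^ 2) := by
  have hx : π ^ 2 * t ^ 2 / 4 * r ^ 2 ≤ exp (π ^ 2 * t ^ 2 / 4 * r ^ 2) := by
    linarith [Real.add_one_le_exp (π ^ 2 * t ^ 2 / 4 * r ^ 2)]
  have hs : exp (-(2 * π ^ 2 * s ^ 2) * r ^ 2) ≤ exp (-(2 * π ^ 2 * (t / 2) ^ 2) * r ^ 2) := by
    gcongr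
  calc 4 * π ^ 2 * s * r ^ 2 * exp (-(2 * π ^ 2 * s ^ 2) * r ^ 2)
      ≤ 4 * π ^ 2 * (3 * t / 2) * r ^ 2 * exp (-(2 * π ^ 2 * (t / 2) ^ 2) * r ^ 2) := by
        gcongr
    _ = 24 / t * ((π ^ 2 * t ^ 2 / 4 * r ^ 2) * exp (-(2 * π ^ 2 * (t / 2) ^ 2) * r ^ 2)) := by
        field_simp; ring
    _ ≤ 24 / t * (exp (π ^ 2 * t ^ 2 / 4 * r ^ 2) * exp (-(2 * π ^ 2 * (t / 2) ^ 2) * r ^ 2)) := by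
        gcongr
    _ = _ := by
        rw [← Real.exp_add]; congr 2; ring

theorem norm_one_sub_exp_sq_le (θ : ℝ) :
    ‖1 - Complex.exp (θ * Complex.I)‖ ^ 2 ≤ 4 ∧ ‖1 - Complex.exp (θ * Complex.I)‖ ^ 2 ≤ θ ^ 2 := by
  have h1 : ‖1 - Complex.exp (θ * Complex.I)‖ ≤ |θ| := by
    rw [norm_sub_rev, mul_comm]
    exact Real.norm_exp_I_mul_ofReal_sub_one_le
  have h2 : ‖1 - Complex.exp (θ * Complex.I)‖ ≤ 2 := by
    refine (norm_sub_le _ _).trans ?_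
    rw [Complex.norm_exp_ofReal_mul_I]
    norm_num
  refine ⟨by nlinarith [norm_nonneg (1 - Complex.exp (θ * Complex.I))], ?_⟩
  rw [← sq_abs θ]
  gcongr

theorem exists_lintegral_norm_one_sub_exp_sq_le (V : Type*) [NormedAddCommGroup V]
    [InnerProductSpace ℝ V] [FiniteDimensional ℝ V] [MeasurableSpace V] [BorelSpace V]
    [Nontrivial V] :
    ∃ K : ℝ, 0 ≤ K ∧ ∀ w : V, ∫⁻ h : V, ENNReal.ofReal
      (‖1 - Complex.exp ((2 * π * ⟪w, h⟫_ℝ : ℝ) * Complex.I)‖ ^ 2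
        / ‖h‖ ^ (Module.finrank ℝ V + 1)) ≤ ENNReal.ofReal (K * ‖w‖) := by
  set n := Module.finrank ℝ V with hn
  have hnpos : 0 < n := Module.finrank_pos
  set g : V → ℝ := fun k => 8 * π ^ 2 * ‖k‖ ^ 2 / (1 + ‖k‖ ^ 2) / ‖k‖ ^ (n + 1) with hg
  have hg0 : ∀ k, 0 ≤ g k := fun k => by positivity
  have hgi : Integrable g := by
    have := (integrable_fun_norm_addHaar (volume : Measure V)
      (f := fun r : ℝ => 8 * π ^ 2 * r ^ 2 / (1 + r ^ 2) / r ^ (n + 1))).2 (by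
        refine ((integrable_inv_one_add_sq.const_mul (8 * π ^ 2)).integrableOn).congr_fun ?_
          measurableSet_Ioi
        intro r hr
        have hr : 0 < r := hr
        have e : r ^ (n + 1) = r ^ (n - 1) * r ^ 2 := by rw [← pow_add]; congr 1; omega
        simp only [smul_eq_mul, ← hn, e]
        field_simp)
    exact this
  refine ⟨∫ k, g k, integral_nonneg hg0, fun w => ?_⟩
  rcases eq_or_ne w 0 with rfl | hw
  · simp
  have hw' : 0 < ‖w‖ := norm_pos_iff.2 hw
  have key : ∀ h : V, ‖1 - Complex.exp ((2 * π * ⟪w, h⟫_ℝ : ℝ) * Complex.I)‖ ^ 2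
        / ‖h‖ ^ (n + 1) ≤ ‖w‖ ^ (n + 1) * g (‖w‖ • h) := by
    intro h
    rcases eq_or_ne h 0 with rfl | hh
    · simp [hg]
    have hh' : 0 < ‖h‖ := norm_pos_iff.2 hh
    obtain ⟨h4, hθ⟩ := norm_one_sub_exp_sq_le (2 * π * ⟪w, h⟫_ℝ)
    set X := ‖1 - Complex.exp ((2 * π * ⟪w, h⟫_ℝ : ℝ) * Complex.I)‖ ^ 2
    have hX0 : 0 ≤ X := by positivity
    have hcs : ⟪w, h⟫_ℝ ^ 2 ≤ (‖w‖ * ‖h‖) ^ 2 := by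
      rw [← sq_abs]; gcongr; exact abs_real_inner_le_norm w h
    set a := ‖w‖ * ‖h‖ with ha
    have hpi : 1 ≤ π ^ 2 := by nlinarith [Real.pi_gt_three]
    have hX : X ≤ 8 * π ^ 2 * a ^ 2 / (1 + a ^ 2) := by
      rw [le_div_iff₀ (by positivity)]
      have h5 : X ≤ 4 * π ^ 2 * a ^ 2 := by
        calc X ≤ (2 * π * ⟪w, h⟫_ℝ) ^ 2 := hθ
          _ = 4 * π ^ 2 * ⟪w, h⟫_ℝ ^ 2 := by ring
          _ ≤ _ := by gcongr
      nlinarith [mul_le_mul_of_nonneg_right h4 (sq_nonneg a),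
        mul_le_mul_of_nonneg_right hpi (sq_nonneg a)]
    have e : ‖w‖ ^ (n + 1) * g (‖w‖ • h) = 8 * π ^ 2 * a ^ 2 / (1 + a ^ 2) / ‖h‖ ^ (n + 1) := by
      simp only [hg, norm_smul, norm_norm, ← ha]
      rw [ha, mul_pow ‖w‖ ‖h‖ (n + 1)]
      field_simp
    rw [e]
    gcongr
  have hgs : Integrable (fun h : V => ‖w‖ ^ (n + 1) * g (‖w‖ • h)) :=
    (hgi.comp_smul hw'.ne').const_mul _
  calc _ ≤ ∫⁻ h : V, ENNReal.ofReal (‖w‖ ^ (n + 1) * g (‖w‖ • h)) :=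
        lintegral_mono fun h => ENNReal.ofReal_le_ofReal (key h)
    _ = ENNReal.ofReal (∫ h : V, ‖w‖ ^ (n + 1) * g (‖w‖ • h)) :=
        (ofReal_integral_eq_lintegral_ofReal hgs
          (.of_forall fun h => mul_nonneg (by positivity) (hg0 _))).symm
    _ = ENNReal.ofReal ((∫ k, g k) * ‖w‖) := by
        rw [integral_const_mul, Measure.integral_comp_smul, ← hn,
          abs_of_nonneg (by positivity), smul_eq_mul]
        congr 1
        field_simp
        ring

theorem le_lintegral_heat_symbol_sq {a ε : ℝ} (ha : 0 < a) (hε : 0 < ε) :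
    ENNReal.ofReal (a / 8 * exp (-1) * exp (-(a ^ 2 * ε ^ 2)))
      ≤ ∫⁻ t in Ioi ε, ENNReal.ofReal ((a ^ 2 * t) ^ 2 * exp (-(a ^ 2 * t ^ 2))) := by
  set S := √(ε ^ 2 + 1 / a ^ 2) with hS
  set T := √(ε ^ 2 + 1 / (2 * a ^ 2)) with hT
  have hS2 : S ^ 2 = ε ^ 2 + 1 / a ^ 2 := Real.sq_sqrt (by positivity)
  have hT2 : T ^ 2 = ε ^ 2 + 1 / (2 * a ^ 2) := Real.sq_sqrt (by positivity)
  have hSpos : 0 < S := Real.sqrt_pos.2 (by positivity)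
  have hTpos : 0 < T := Real.sqrt_pos.2 (by positivity)
  have hdiff : S ^ 2 - T ^ 2 = 1 / (2 * a ^ 2) := by rw [hS2, hT2]; field_simp; ring
  have hεT : ε ≤ T := Real.le_sqrt_of_sq_le (by have : 0 < 1 / (2 * a ^ 2) := by positivity
                                                linarith)
  have haS : 1 / a ≤ S := Real.le_sqrt_of_sq_le (by rw [div_pow, one_pow]; nlinarith)
  have hTS : T < S := by
    have : 0 < 1 / (2 * a ^ 2) := by positivity
    nlinarith
  have hlen : 1 / (4 * a ^ 2 * S) ≤ S - T := by
    have h : (S - T) * (2 * S) ≥ 1 / (2 * a ^ 2) := by nlinarith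
    have e : 1 / (4 * a ^ 2 * S) = 1 / (2 * a ^ 2) / (2 * S) := by field_simp; norm_num
    rw [e, div_le_iff₀ (by positivity)]
    exact h
  have hST : S ^ 2 / 2 ≤ T ^ 2 := by
    have : 1 / (2 * a ^ 2) = 1 / a ^ 2 / 2 := by field_simp
    rw [hS2, hT2, this]
    nlinarith [sq_nonneg ε]
  set c := a ^ 4 * (S ^ 2 / 2) * (exp (-1) * exp (-(a ^ 2 * ε ^ 2))) with hc
  have hcle : ∀ t ∈ Ioc T S, c ≤ (a ^ 2 * t) ^ 2 * exp (-(a ^ 2 * t ^ 2)) := by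
    rintro t ⟨h1, h2⟩
    have htS : t ^ 2 ≤ S ^ 2 := by have := hTpos.trans h1; gcongr
    have hTt : T ^ 2 ≤ t ^ 2 := by gcongr
    have e : (a ^ 2 * t) ^ 2 = a ^ 4 * t ^ 2 := by ring
    rw [hc, ← Real.exp_add, e]
    gcongr
    · linarith
    · have : a ^ 2 * t ^ 2 ≤ a ^ 2 * S ^ 2 := by gcongr
      have e : a ^ 2 * S ^ 2 = a ^ 2 * ε ^ 2 + 1 := by rw [hS2]; field_simp
      linarith
  calc ENNReal.ofReal (a / 8 * exp (-1) * exp (-(a ^ 2 * ε ^ 2)))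
      ≤ ENNReal.ofReal (c * (S - T)) := by
        apply ENNReal.ofReal_le_ofReal
        calc a / 8 * exp (-1) * exp (-(a ^ 2 * ε ^ 2))
            = a ^ 2 / 8 * (1 / a) * (exp (-1) * exp (-(a ^ 2 * ε ^ 2))) := by field_simp
          _ ≤ a ^ 2 / 8 * S * (exp (-1) * exp (-(a ^ 2 * ε ^ 2))) := by gcongr
          _ = c * (1 / (4 * a ^ 2 * S)) := by rw [hc]; field_simp; norm_num
          _ ≤ c * (S - T) := by gcongr
    _ = ∫⁻ t in Ioc T S, ENNReal.ofReal c := by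
        rw [setLIntegral_const, Real.volume_Ioc, ENNReal.ofReal_mul (by positivity)]
    _ ≤ ∫⁻ t in Ioc T S, ENNReal.ofReal ((a ^ 2 * t) ^ 2 * exp (-(a ^ 2 * t ^ 2))) :=
        setLIntegral_mono' measurableSet_Ioc fun t ht => ENNReal.ofReal_le_ofReal (hcle t ht)
    _ ≤ _ := lintegral_mono_set fun t ht => lt_of_le_of_lt hεT ht.1

theorem hasDerivAt_exp_heat (s r : ℝ) :
    HasDerivAt (fun s : ℝ => exp (-(2 * π ^ 2 * s ^ 2) * r ^ 2))
      (-(4 * π ^ 2 * s * r ^ 2 * exp (-(2 * π ^ 2 * s ^ 2) * r ^ 2))) s := by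
  have h := ((((hasDerivAt_pow 2 s).const_mul (2 * π ^ 2)).neg).mul_const (r ^ 2)).exp
  refine h.congr_deriv ?_
  simp only [Pi.neg_apply]
  push_cast
  ring

/-- Symbol of the time derivative of the heat flow, acting on the spectrum `f`. -/
noncomputable def heatDerivSymbol {V : Type*} [NormedAddCommGroup V] (f : V → ℂ) (t : ℝ) (w : V) :
    ℂ :=
  f w * (-(4 * π ^ 2 * t * ‖w‖ ^ 2 * exp (-(2 * π ^ 2 * t ^ 2) * ‖w‖ ^ 2)) : ℝ)

theorem norm_heatDerivSymbol_le {V : Type*} [NormedAddCommGroup V] {f : V → ℂ} {M : ℝ}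
    (hM : ∀ w, ‖f w‖ ≤ M) {s t : ℝ} (ht : 0 < t)
    (h1 : t / 2 ≤ s) (h2 : s ≤ 3 * t / 2) (w : V) :
    ‖heatDerivSymbol f s w‖ ≤ M * (24 / t) * exp (-(π ^ 2 * t ^ 2 / 4) * ‖w‖ ^ 2) := by
  have hs : 0 < s := by linarith
  have hM0 : 0 ≤ M := (norm_nonneg _).trans (hM w)
  rw [heatDerivSymbol, norm_mul, Complex.norm_real, norm_neg, Real.norm_of_nonneg (by positivity),
    mul_assoc M]
  exact mul_le_mul (hM w) (heat_symbol_le ht h1 h2) (by positivity) hM0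

section HeatFlow

variable {V : Type*} [NormedAddCommGroup V] [InnerProductSpace ℝ V] [FiniteDimensional ℝ V]
  [MeasurableSpace V] [BorelSpace V] {f : V → ℂ} {M : ℝ}

theorem integrable_and_memLp_two_heatDerivSymbol (hf : Continuous f) (hM : ∀ w, ‖f w‖ ≤ M)
    {t : ℝ} (ht : 0 < t) :
    Integrable (heatDerivSymbol f t) ∧ MemLp (heatDerivSymbol f t) 2 :=
  integrable_and_memLp_two_of_norm_le_gaussian (by unfold heatDerivSymbol; fun_prop)
    (c := π ^ 2 * t ^ 2 / 4) (by positivity)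
    (norm_heatDerivSymbol_le hM ht (by linarith) (by linarith))

theorem integrable_and_memLp_two_mul_exp (hf : Continuous f) (hM : ∀ w, ‖f w‖ ≤ M)
    {t : ℝ} (ht : 0 < t) :
    Integrable (fun w => f w * (exp (-(2 * π ^ 2 * t ^ 2) * ‖w‖ ^ 2) : ℝ)) ∧
      MemLp (fun w => f w * (exp (-(2 * π ^ 2 * t ^ 2) * ‖w‖ ^ 2) : ℝ)) 2 := by
  refine integrable_and_memLp_two_of_norm_le_gaussian (by fun_prop) (K := M)
    (c := 2 * π ^ 2 * t ^ 2) (by positivity) fun w => ?_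
  rw [norm_mul, Complex.norm_real, Real.norm_of_nonneg (by positivity)]
  exact mul_le_mul_of_nonneg_right (hM w) (by positivity)

theorem hasDerivAt_fourierInv_mul_exp (hf : Continuous f) (hM : ∀ w, ‖f w‖ ≤ M)
    {t : ℝ} (ht : 0 < t) (x : V) :
    HasDerivAt (fun s : ℝ => 𝓕⁻ (fun w => f w * (exp (-(2 * π ^ 2 * s ^ 2) * ‖w‖ ^ 2) : ℝ)) x)
      (𝓕⁻ (heatDerivSymbol f t) x) t := by
  simp only [fourierInv_eq']
  have hnorm : ∀ w : V, ‖Complex.exp (↑(2 * π * ⟪w, x⟫_ℝ) * Complex.I)‖ = 1 :=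
    fun w => Complex.norm_exp_ofReal_mul_I _
  refine (hasDerivAt_integral_of_dominated_loc_of_deriv_le
    (F := fun (s : ℝ) (w : V) => Complex.exp (↑(2 * π * ⟪w, x⟫_ℝ) * Complex.I) •
      (f w * ((exp (-(2 * π ^ 2 * s ^ 2) * ‖w‖ ^ 2) : ℝ) : ℂ)))
    (F' := fun s w => Complex.exp (↑(2 * π * ⟪w, x⟫_ℝ) * Complex.I) • heatDerivSymbol f s w)
    (bound := fun w => M * (24 / t) * exp (-(π ^ 2 * t ^ 2 / 4) * ‖w‖ ^ 2))
    (Icc_mem_nhds (a := t / 2) (b := 3 * t / 2) (by linarith) (by linarith)) ?_ ?_ ?_ ?_ ?_ ?_).2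
  · refine .of_forall fun s => Continuous.aestronglyMeasurable ?_
    fun_prop
  · refine (integrable_and_memLp_two_mul_exp hf hM ht).1.norm.mono'
      (Continuous.aestronglyMeasurable (by fun_prop)) (.of_forall fun w => ?_)
    rw [norm_smul, hnorm, one_mul]
  · refine Continuous.aestronglyMeasurable ?_
    unfold heatDerivSymbol
    fun_prop
  · refine .of_forall fun w s hs => ?_
    rw [norm_smul, hnorm, one_mul]
    exact norm_heatDerivSymbol_le hM ht hs.1 hs.2 w
  · refine (integrable_and_memLp_two_of_norm_le_gaussian (V := V)
      (f := fun w => ((M * (24 / t) * exp (-(π ^ 2 * t ^ 2 / 4) * ‖w‖ ^ 2) : ℝ) : ℂ))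
      (K := |M * (24 / t)|) (c := π ^ 2 * t ^ 2 / 4) (by fun_prop) (by positivity)
      fun w => ?_).1.re
    rw [Complex.norm_real, norm_mul, Real.norm_eq_abs, Real.norm_of_nonneg (exp_nonneg _)]
  · refine .of_forall fun w s _ => ?_
    exact (((hasDerivAt_exp_heat s ‖w‖).ofReal_comp).const_mul (f w)).const_mul _

theorem lintegral_enorm_fourierInv_sub_translate_sq (hf : Integrable f) (hf2 : MemLp f 2) (h : V) :
    ∫⁻ x, ‖𝓕⁻ f x - 𝓕⁻ f (x + h)‖ₑ ^ 2
      = ∫⁻ w, ‖f w * (1 - Complex.exp ((2 * π * ⟪w, h⟫_ℝ : ℝ) * Complex.I))‖ₑ ^ 2 := by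
  have hcont : Continuous fun w : V =>
      1 - Complex.exp ((2 * π * ⟪w, h⟫_ℝ : ℝ) * Complex.I) := by fun_prop
  have hle : ∀ w : V, ‖f w * (1 - Complex.exp ((2 * π * ⟪w, h⟫_ℝ : ℝ) * Complex.I))‖
      ≤ 2 * ‖f w‖ := by
    intro w
    rw [norm_mul, mul_comm]
    gcongr
    refine (norm_sub_le _ _).trans ?_
    rw [Complex.norm_exp_ofReal_mul_I]
    norm_num
  have hm := hf.aestronglyMeasurable.mul hcont.aestronglyMeasurable
  have hi := (hf.norm.const_mul 2).mono' hm (.of_forall hle)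
  have hi2 : MemLp _ 2 volume := hf2.of_le_mul hm (.of_forall hle)
  refine Eq.trans ?_ (lintegral_enorm_fourierInv_sq hi hi2)
  congr 1
  ext x
  congr 2
  simp only [fourierInv_eq']
  have hexp : ∀ x : V, Integrable fun w : V =>
      Complex.exp (↑(2 * π * ⟪w, x⟫_ℝ) * Complex.I) • f w := by
    intro x
    have hc : Continuous fun w : V => Complex.exp (↑(2 * π * ⟪w, x⟫_ℝ) * Complex.I) := by fun_prop
    refine hf.norm.mono' (hc.aestronglyMeasurable.smul hf.aestronglyMeasurable)
      (.of_forall fun w => ?_)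
    rw [norm_smul, Complex.norm_exp_ofReal_mul_I, one_mul]
  rw [← integral_sub (hexp x) (hexp (x + h))]
  congr 1
  ext w
  rw [inner_add_right, mul_add, Complex.ofReal_add, add_mul, Complex.exp_add]
  simp only [smul_eq_mul]
  ring

end HeatFlow

section Mollify

variable {n : ℕ} {u : EuclideanSpace ℝ (Fin n) → ℝ}

theorem continuous_fourier_ofReal (hu : Integrable u) : Continuous (𝓕 (fun y => (u y : ℂ))) :=
  VectorFourier.fourierIntegral_continuous Real.continuous_fourierChar
    (by exact continuous_inner) hu.ofReal

theorem norm_fourier_ofReal_le (w : EuclideanSpace ℝ (Fin n)) :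
    ‖𝓕 (fun y => (u y : ℂ)) w‖ ≤ ∫ y, ‖(u y : ℂ)‖ :=
  VectorFourier.norm_fourierIntegral_le_integral_norm _ _ _ _ _

theorem continuous_mollify (hu : Integrable u) {t : ℝ} (ht : 0 < t) : Continuous (mollify u t) := by
  have hi := (integrable_and_memLp_two_mul_exp (continuous_fourier_ofReal hu)
    norm_fourier_ofReal_le ht).1
  have hc := Complex.continuous_re.comp <|
    (VectorFourier.fourierIntegral_continuous Real.continuous_fourierChar
      (L := innerₗ (EuclideanSpace ℝ (Fin n))) (by exact continuous_inner) hi).comp continuous_neg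
  convert hc using 1
  ext x
  rw [← Complex.ofReal_re (mollify u t x), ofReal_mollify_eq_fourierInv hu ht,
    fourierInv_eq_fourier_neg]
  rfl

theorem ofReal_deriv_mollify (hu : Integrable u) {t : ℝ} (ht : 0 < t)
    (x : EuclideanSpace ℝ (Fin n)) :
    ((deriv (fun s => mollify u s x) t : ℝ) : ℂ)
      = 𝓕⁻ (heatDerivSymbol (𝓕 (fun y => (u y : ℂ))) t) x := by
  have h : HasDerivAt (fun s => (mollify u s x : ℂ))
      (𝓕⁻ (heatDerivSymbol (𝓕 (fun y => (u y : ℂ))) t) x) t := by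
    refine (hasDerivAt_fourierInv_mul_exp (continuous_fourier_ofReal hu)
      norm_fourier_ofReal_le ht x).congr_of_eventuallyEq ?_
    filter_upwards [lt_mem_nhds ht] with s hs
    exact ofReal_mollify_eq_fourierInv hu hs x
  have hre : HasDerivAt (fun s => mollify u s x)
      (𝓕⁻ (heatDerivSymbol (𝓕 (fun y => (u y : ℂ))) t) x).re t := by
    exact Complex.reCLM.hasFDerivAt.comp_hasDerivAt t h
  rw [hre.deriv]
  exact hre.ofReal_comp.unique h

theorem enorm_sq_eq_ofReal_norm_sq (z : ℂ) : ‖z‖ₑ ^ 2 = ENNReal.ofReal (‖z‖ ^ 2) := by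
  rw [ENNReal.ofReal_pow (norm_nonneg _), ofReal_norm]

theorem lintegral_deriv_mollify_sq (hu : Integrable u) {t : ℝ} (ht : 0 < t) :
    ∫⁻ x, ENNReal.ofReal ((deriv (fun s => mollify u s x) t) ^ 2)
      = ∫⁻ w, ENNReal.ofReal (‖𝓕 (fun y => (u y : ℂ)) w‖ ^ 2) *
          ENNReal.ofReal (((2 * π * ‖w‖) ^ 2 * t) ^ 2 *
            exp (-((2 * π * ‖w‖) ^ 2 * t ^ 2))) := by
  obtain ⟨hi, hi2⟩ := integrable_and_memLp_two_heatDerivSymbol (continuous_fourier_ofReal hu)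
    norm_fourier_ofReal_le ht
  have e (x : EuclideanSpace ℝ (Fin n)) :
      ENNReal.ofReal ((deriv (fun s => mollify u s x) t) ^ 2)
        = ‖𝓕⁻ (heatDerivSymbol (𝓕 (fun y => (u y : ℂ))) t) x‖ₑ ^ 2 := by
    rw [enorm_sq_eq_ofReal_norm_sq, ← ofReal_deriv_mollify hu ht, Complex.norm_real,
      Real.norm_eq_abs, sq_abs]
  simp_rw [e]
  rw [lintegral_enorm_fourierInv_sq hi hi2]
  congr 1
  ext w
  rw [enorm_sq_eq_ofReal_norm_sq, ← ENNReal.ofReal_mul (by positivity)]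
  congr 1
  rw [heatDerivSymbol, norm_mul, Complex.norm_real, norm_neg, Real.norm_of_nonneg (by positivity),
    mul_pow, mul_pow _ (exp _), ← Real.exp_nat_mul]
  congr 2
  · ring
  · congr 1
    push_cast
    ring

theorem lintegral_mollify_sub_translate_sq (hu : Integrable u) {t : ℝ} (ht : 0 < t)
    (h : EuclideanSpace ℝ (Fin n)) :
    ∫⁻ x, ENNReal.ofReal (|mollify u t x - mollify u t (x + h)| ^ 2)
      = ∫⁻ w, ENNReal.ofReal (‖𝓕 (fun y => (u y : ℂ)) w‖ ^ 2 *
          exp (-((2 * π * ‖w‖) ^ 2 * t ^ 2))) *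
            ENNReal.ofReal (‖1 - Complex.exp ((2 * π * ⟪w, h⟫_ℝ : ℝ) * Complex.I)‖ ^ 2) := by
  obtain ⟨hi, hi2⟩ := integrable_and_memLp_two_mul_exp (continuous_fourier_ofReal hu)
    norm_fourier_ofReal_le ht
  have e (a b : ℝ) :
      ENNReal.ofReal (|a - b| ^ 2) = ‖(a : ℂ) - (b : ℂ)‖ₑ ^ 2 := by
    rw [enorm_sq_eq_ofReal_norm_sq, ← Complex.ofReal_sub, Complex.norm_real, Real.norm_eq_abs]
  simp_rw [e, ofReal_mollify_eq_fourierInv hu ht]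
  rw [lintegral_enorm_fourierInv_sub_translate_sq hi hi2]
  congr 1
  ext w
  rw [enorm_sq_eq_ofReal_norm_sq, ← ENNReal.ofReal_mul (by positivity)]
  congr 1
  rw [norm_mul, norm_mul, Complex.norm_real, Real.norm_of_nonneg (exp_nonneg _), mul_pow, mul_pow,
    ← Real.exp_nat_mul]
  congr 3
  push_cast
  ring

theorem H12_mollify_le_lintegral [NeZero n] {K : ℝ}
    (hK : ∀ w : EuclideanSpace ℝ (Fin n), ∫⁻ h, ENNReal.ofReal
      (‖1 - Complex.exp ((2 * π * ⟪w, h⟫_ℝ : ℝ) * Complex.I)‖ ^ 2 / ‖h‖ ^ (n + 1))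
        ≤ ENNReal.ofReal (K * ‖w‖)) (hu : Integrable u) {t : ℝ} (ht : 0 < t) :
    H12 (mollify u t) ≤ ∫⁻ w, ENNReal.ofReal (‖𝓕 (fun y => (u y : ℂ)) w‖ ^ 2 *
          exp (-((2 * π * ‖w‖) ^ 2 * t ^ 2))) * ENNReal.ofReal (K * ‖w‖) := by
  have hv := (continuous_mollify hu ht).measurable
  have hf := (continuous_fourier_ofReal hu).measurable
  calc H12 (mollify u t)
      = ∫⁻ x, ∫⁻ h, ENNReal.ofReal (|mollify u t x - mollify u t (x + h)| ^ 2 / ‖h‖ ^ (n + 1)) := by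
        rw [H12]
        congr 1
        ext x
        rw [← lintegral_add_left_eq_self _ x]
        simp
    _ = ∫⁻ h, ∫⁻ x, ENNReal.ofReal (|mollify u t x - mollify u t (x + h)| ^ 2 / ‖h‖ ^ (n + 1)) :=
        lintegral_lintegral_swap (by unfold Function.uncurry; fun_prop)
    _ = ∫⁻ h, ∫⁻ w, ENNReal.ofReal (‖𝓕 (fun y => (u y : ℂ)) w‖ ^ 2 *
          exp (-((2 * π * ‖w‖) ^ 2 * t ^ 2))) * ENNReal.ofReal
            (‖1 - Complex.exp ((2 * π * ⟪w, h⟫_ℝ : ℝ) * Complex.I)‖ ^ 2 / ‖h‖ ^ (n + 1)) := by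
        congr 1
        ext h
        simp_rw [div_eq_mul_inv,
          fun a : ℝ => ENNReal.ofReal_mul (sq_nonneg a) (q := (‖h‖ ^ (n + 1))⁻¹), ← mul_assoc]
        rw [lintegral_mul_const' _ _ ENNReal.ofReal_ne_top,
          lintegral_mul_const' _ _ ENNReal.ofReal_ne_top, lintegral_mollify_sub_translate_sq hu ht]
    _ = ∫⁻ w, ∫⁻ h, ENNReal.ofReal (‖𝓕 (fun y => (u y : ℂ)) w‖ ^ 2 *
          exp (-((2 * π * ‖w‖) ^ 2 * t ^ 2))) * ENNReal.ofReal
            (‖1 - Complex.exp ((2 * π * ⟪w, h⟫_ℝ : ℝ) * Complex.I)‖ ^ 2 / ‖h‖ ^ (n + 1)) :=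
        lintegral_lintegral_swap (by unfold Function.uncurry; fun_prop)
    _ ≤ _ := by
        refine lintegral_mono fun w => ?_
        rw [lintegral_const_mul' _ _ ENNReal.ofReal_ne_top]
        exact mul_le_mul_right (hK w) _

theorem lintegral_le_lintegral_deriv_mollify_sq (hu : Integrable u) {ε : ℝ} (hε : 0 < ε) :
    ∫⁻ w, ENNReal.ofReal (‖𝓕 (fun y => (u y : ℂ)) w‖ ^ 2 *
        exp (-((2 * π * ‖w‖) ^ 2 * ε ^ 2))) * ENNReal.ofReal (π * exp (-1) / 4 * ‖w‖)
      ≤ ∫⁻ t in Ioi ε, ∫⁻ x, ENNReal.ofReal ((deriv (fun s => mollify u s x) t) ^ 2) := by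
  have hf := (continuous_fourier_ofReal hu).measurable
  calc _ ≤ ∫⁻ w, ∫⁻ t in Ioi ε, ENNReal.ofReal (‖𝓕 (fun y => (u y : ℂ)) w‖ ^ 2) *
          ENNReal.ofReal (((2 * π * ‖w‖) ^ 2 * t) ^ 2 *
            exp (-((2 * π * ‖w‖) ^ 2 * t ^ 2))) := by
        refine lintegral_mono fun w => ?_
        rcases eq_or_ne w 0 with rfl | hw
        · simp
        have hw' : 0 < 2 * π * ‖w‖ := by have := norm_pos_iff.2 hw; positivity
        rw [lintegral_const_mul' _ _ ENNReal.ofReal_ne_top, ENNReal.ofReal_mul (by positivity),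
          mul_assoc, ← ENNReal.ofReal_mul (by positivity)]
        refine mul_le_mul_right ((le_of_eq ?_).trans (le_lintegral_heat_symbol_sq hw' hε)) _
        congr 1
        ring
    _ = ∫⁻ t in Ioi ε, ∫⁻ w, ENNReal.ofReal (‖𝓕 (fun y => (u y : ℂ)) w‖ ^ 2) *
          ENNReal.ofReal (((2 * π * ‖w‖) ^ 2 * t) ^ 2 *
            exp (-((2 * π * ‖w‖) ^ 2 * t ^ 2))) :=
        lintegral_lintegral_swap (by unfold Function.uncurry; fun_prop)
    _ = _ := (setLIntegral_congr_fun measurableSet_Ioi fun t ht =>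
        lintegral_deriv_mollify_sq hu (hε.trans ht)).symm

end Mollify

/-- For `u` supported in the unit ball with `|u| ≤ 1` and `u_t = u ∗ γ_{n,t}`, the squared
`H^{1/2}` norm of `u_ε` is controlled by the heat-flow energy
`C ∫_ε^∞ ∫_{ℝⁿ} |∂_t u_t(x)|² dx dt`, with `C` a dimensional constant. -/
theorem H12_mollify_le_heat_energy {n : ℕ} :
    ∃ C : ℝ, 0 < C ∧ ∀ u : EuclideanSpace ℝ (Fin n) → ℝ,
      Integrable u → (∀ x, |u x| ≤ 1) → Function.support u ⊆ Metric.closedBall 0 1 →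
      ∀ ε : ℝ, 0 < ε →
        H12 (mollify u ε) ≤ ENNReal.ofReal C *
          ∫⁻ t in Ioi ε, ∫⁻ x, ENNReal.ofReal ((deriv (fun s => mollify u s x) t) ^ 2) := by
  rcases Nat.eq_zero_or_pos n with rfl | hn
  · refine ⟨1, one_pos, fun u _ _ _ ε _ => ?_⟩
    have h0 : H12 (mollify u ε) = 0 := by
      rw [H12]
      simp [Subsingleton.elim (_ : EuclideanSpace ℝ (Fin 0)) 0]
    rw [h0]
    exact bot_le
  have : NeZero n := ⟨hn.ne'⟩
  obtain ⟨K, hK0, hK⟩ := exists_lintegral_norm_one_sub_exp_sq_le (EuclideanSpace ℝ (Fin n))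
  rw [finrank_euclideanSpace_fin] at hK
  have hc : 0 < π * exp (-1) / 4 := by positivity
  refine ⟨K / (π * exp (-1) / 4) + 1, by positivity, fun u hu _ _ ε hε => ?_⟩
  refine (H12_mollify_le_lintegral hK hu hε).trans ?_
  refine le_trans ?_ (mul_le_mul_right (lintegral_le_lintegral_deriv_mollify_sq hu hε) _)
  rw [← lintegral_const_mul' _ _ ENNReal.ofReal_ne_top]
  refine lintegral_mono fun w => ?_
  rw [mul_left_comm, ← ENNReal.ofReal_mul (p := K / _ + 1) (by positivity)]
  refine mul_le_mul_right (ENNReal.ofReal_le_ofReal ?_) _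
  rw [← mul_assoc, add_mul, div_mul_cancel₀ _ hc.ne']
  gcongr
  linarith
end

section
/- Let u ∈ BV(ℝⁿ) with |u| ≤ 1 and u_t = u ∗ γ_{n,t}. Then for every t > 0: (i) ∫ |∂_t u_t| dx ≤ C ∫ |∇u|, (ii) ‖∂_t u_t‖_∞ ≤ C/t, and consequently ∫ |∂_t u_t|² dx ≤ (C/t) ∫ |∇u|, where C is a dimensional constant. -/
open MeasureTheory Set Real

/-- Divergence of a vector field on `ℝⁿ`. -/
noncomputable def diverg {n : ℕ}
    (φ : EuclideanSpace ℝ (Fin n) → EuclideanSpace ℝ (Fin n))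
    (x : EuclideanSpace ℝ (Fin n)) : ℝ :=
  ∑ i : Fin n, fderiv ℝ φ x (EuclideanSpace.single i 1) i

/-- The set of values `∫ u · div φ` over smooth compactly supported vector fields `φ`
with `‖φ‖ ≤ 1`; its supremum is the total variation `∫ |∇u|`. -/
def varSet {n : ℕ} (u : EuclideanSpace ℝ (Fin n) → ℝ) : Set ℝ :=
  {r | ∃ φ : EuclideanSpace ℝ (Fin n) → EuclideanSpace ℝ (Fin n),
    ContDiff ℝ (⊤ : ℕ∞) φ ∧ HasCompactSupport φ ∧ (∀ x, ‖φ x‖ ≤ 1) ∧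
    r = ∫ x, u x * diverg φ x}

/-- The total variation `∫_{ℝⁿ} |∇u|` of a function `u : ℝⁿ → ℝ`. -/
noncomputable def totalVar {n : ℕ} (u : EuclideanSpace ℝ (Fin n) → ℝ) : ℝ :=
  sSup (varSet u)

/-- `u ∈ BV(ℝⁿ)`: `u` is integrable and its distributional gradient has finite mass. -/
def IsBV {n : ℕ} (u : EuclideanSpace ℝ (Fin n) → ℝ) : Prop :=
  Integrable u ∧ BddAbove (varSet u)

open scoped ContDiff

theorem diverg_smul_const {n : ℕ} {f : EuclideanSpace ℝ (Fin n) → ℝ}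
    (hf : Differentiable ℝ f) (v x : EuclideanSpace ℝ (Fin n)) :
    diverg (fun y => f y • v) x = fderiv ℝ f x v := by
  have h : ∀ i, fderiv ℝ (fun y => f y • v) x (EuclideanSpace.single i 1) i
      = v i • fderiv ℝ f x (EuclideanSpace.single i 1) := fun i => by
    rw [fderiv_smul_const (hf x)]
    simp [mul_comm]
  simp only [diverg, h, ← map_smul, ← map_sum]
  congr 1
  ext i
  simp [Finset.sum_apply, Pi.single_apply]

theorem zero_mem_varSet {n : ℕ} (u : EuclideanSpace ℝ (Fin n) → ℝ) : 0 ∈ varSet u :=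
  ⟨fun _ => 0, contDiff_const, HasCompactSupport.zero, by simp, by simp [diverg]⟩

theorem totalVar_nonneg {n : ℕ} {u : EuclideanSpace ℝ (Fin n) → ℝ} (hu : BddAbove (varSet u)) :
    0 ≤ totalVar u :=
  le_csSup hu (zero_mem_varSet u)

/-- Testing the distributional gradient of `u` against `ψ • v`. -/
theorem integral_mul_fderiv_le {n : ℕ} {u : EuclideanSpace ℝ (Fin n) → ℝ}
    (hu : BddAbove (varSet u)) {ψ : EuclideanSpace ℝ (Fin n) → ℝ} (hψ : ContDiff ℝ ∞ ψ)
    (hc : HasCompactSupport ψ) (h1 : ∀ x, |ψ x| ≤ 1) (v : EuclideanSpace ℝ (Fin n)) :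
    ∫ x, u x * fderiv ℝ ψ x v ≤ ‖v‖ * totalVar u := by
  have hd : Differentiable ℝ ψ := hψ.differentiable (by simp)
  have hmem : (∫ x, u x * fderiv ℝ ψ x (‖v‖⁻¹ • v)) ∈ varSet u := by
    refine ⟨fun x => ψ x • (‖v‖⁻¹ • v), hψ.smul contDiff_const, hc.smul_right, fun x => ?_, ?_⟩
    · rw [norm_smul, norm_smul, norm_inv, norm_norm]
      exact mul_le_one₀ (h1 x) (by positivity) (inv_mul_le_one)
    · simp only [diverg_smul_const hd]
  have hv : v = ‖v‖ • (‖v‖⁻¹ • v) := by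
    rcases eq_or_ne v 0 with rfl | h
    · simp
    · rw [smul_inv_smul₀ (norm_ne_zero_iff.2 h)]
  calc ∫ x, u x * fderiv ℝ ψ x v
      = ‖v‖ * ∫ x, u x * fderiv ℝ ψ x (‖v‖⁻¹ • v) := by
        rw [← integral_const_mul]
        congr 1 with x
        conv_lhs => rw [hv, map_smul, smul_eq_mul]
        ring
    _ ≤ ‖v‖ * totalVar u := by
        gcongr
        exact le_csSup hu hmem

/-- The `L¹` norm is bounded by duality against smooth compactly supported functions. -/
theorem integral_abs_le_of_forall_test {n : ℕ} {F : EuclideanSpace ℝ (Fin n) → ℝ}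
    (hF : Integrable F) {B : ℝ}
    (hB : ∀ ψ : EuclideanSpace ℝ (Fin n) → ℝ, ContDiff ℝ ∞ ψ → HasCompactSupport ψ →
      (∀ x, |ψ x| ≤ 1) → ∫ x, F x * ψ x ≤ B) :
    ∫ x, |F x| ≤ B := by
  refine le_of_forall_pos_le_add fun ε hε => ?_
  obtain ⟨g, hgc, hgs, hg⟩ := MemLp.exist_eLpNorm_sub_le (p := 1) (by simp) le_rfl
    (memLp_one_iff_integrable.2 hF) (ε := ε / 4) (by positivity)
  have hgi : Integrable g := hgs.continuous.integrable_of_hasCompactSupport hgc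
  have hFg : ∫ x, |F x - g x| ≤ ε / 4 := by
    rw [eLpNorm_one_eq_lintegral_enorm] at hg
    have := ENNReal.toReal_mono ENNReal.ofReal_ne_top hg
    rw [ENNReal.toReal_ofReal (by positivity)] at this
    rwa [← integral_norm_eq_lintegral_enorm (hF.sub hgi).aestronglyMeasurable] at this
  set m := (volume (tsupport g)).toReal
  have hmfin : volume (tsupport g) ≠ ⊤ := hgc.isCompact.measure_lt_top.ne
  set δ := ε / (2 * (m + 1)) with hδdef
  have hm0 : 0 ≤ m := ENNReal.toReal_nonneg
  have hδ : 0 < δ := by positivity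
  have hpos : ∀ x, 0 < g x ^ 2 + δ ^ 2 := fun x => by positivity
  set ψ : EuclideanSpace ℝ (Fin n) → ℝ := fun x => g x * (√(g x ^ 2 + δ ^ 2))⁻¹ with hψdef
  have hψs : ContDiff ℝ ∞ ψ :=
    hgs.mul ((((hgs.pow 2).add contDiff_const).sqrt fun x => (hpos x).ne').inv
      fun x => (Real.sqrt_pos.2 (hpos x)).ne')
  have hψc : HasCompactSupport ψ := hgc.mul_right
  have hψ1 : ∀ x, |ψ x| ≤ 1 := fun x => by
    rw [hψdef, abs_mul, abs_inv, abs_of_pos (Real.sqrt_pos.2 (hpos x)), ← div_eq_mul_inv,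
      div_le_one (Real.sqrt_pos.2 (hpos x))]
    exact Real.abs_le_sqrt (by nlinarith)
  have hψm : AEStronglyMeasurable ψ := hψs.continuous.aestronglyMeasurable
  have hψb : ∀ᵐ x, ‖ψ x‖ ≤ 1 := Filter.Eventually.of_forall hψ1
  have hδi : Integrable ((tsupport g).indicator fun _ => δ) :=
    (integrable_indicator_iff (isClosed_tsupport g).measurableSet).2
      (integrableOn_const hmfin)
  have hpt : ∀ x, |F x| ≤ F x * ψ x + 2 * |F x - g x| + (tsupport g).indicator (fun _ => δ) x := by
    intro x
    have h2 : |g x| ≤ g x * ψ x + (tsupport g).indicator (fun _ => δ) x := by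
      by_cases hx : x ∈ tsupport g
      · rw [indicator_of_mem hx]
        have hs := Real.sqrt_pos.2 (hpos x)
        have hle : √(g x ^ 2 + δ ^ 2) ≤ |g x| + δ := by
          refine Real.sqrt_le_iff.2 ⟨by positivity, ?_⟩
          nlinarith [sq_abs (g x), abs_nonneg (g x)]
        have : g x * ψ x = |g x| ^ 2 / √(g x ^ 2 + δ ^ 2) := by
          rw [hψdef, sq_abs]; ring
        rw [this, ← sub_le_iff_le_add, le_div_iff₀ hs]
        by_cases hgd : |g x| ≤ δ
        · nlinarith [abs_nonneg (g x)]
        · nlinarith [abs_nonneg (g x)]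
      · rw [indicator_of_notMem hx, image_eq_zero_of_notMem_tsupport hx]; simp
    have h3 : |F x| ≤ |g x| + |F x - g x| := by
      simpa using abs_add_le (g x) (F x - g x)
    have h4 : g x * ψ x ≤ F x * ψ x + |F x - g x| := by
      have : -((F x - g x) * ψ x) ≤ |F x - g x| := by
        refine (neg_le_abs _).trans ?_
        rw [abs_mul]
        exact mul_le_of_le_one_right (abs_nonneg _) (hψ1 x)
      linarith
    linarith
  have i1 : Integrable fun x => F x * ψ x := hF.mul_bdd hψm hψb
  have i2 : Integrable fun x => 2 * |F x - g x| := (hF.sub hgi).abs.const_mul 2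
  have i3 : Integrable fun x => F x * ψ x + 2 * |F x - g x| := i1.add i2
  calc ∫ x, |F x|
      ≤ ∫ x, (F x * ψ x + 2 * |F x - g x| + (tsupport g).indicator (fun _ => δ) x) :=
        integral_mono hF.abs (i3.add hδi) hpt
    _ = (∫ x, F x * ψ x) + 2 * (∫ x, |F x - g x|) + m * δ := by
        rw [integral_add i3 hδi, integral_add i1 i2, integral_const_mul,
          integral_indicator (isClosed_tsupport g).measurableSet, setIntegral_const,
          smul_eq_mul]
        rfl
    _ ≤ B + 2 * (ε / 4) + ε / 2 := by
        have : m * δ ≤ ε / 2 := by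
          rw [hδdef, mul_div_assoc', div_le_iff₀ (by positivity)]
          nlinarith
        have := hB ψ hψs hψc hψ1
        linarith
    _ = B + ε := by ring

/-- `τ ↦ ∫ u(x) ψ(x - τ h) dx` has derivative bounded by `‖h‖ ∫ |∇u|`. -/
theorem integral_mul_comp_sub_sub_le {n : ℕ} {u : EuclideanSpace ℝ (Fin n) → ℝ} (hu : IsBV u)
    {ψ : EuclideanSpace ℝ (Fin n) → ℝ} (hψ : ContDiff ℝ ∞ ψ) (hc : HasCompactSupport ψ)
    (h1 : ∀ x, |ψ x| ≤ 1) (h : EuclideanSpace ℝ (Fin n)) :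
    (∫ x, u x * ψ (x - h)) - ∫ x, u x * ψ x ≤ ‖h‖ * totalVar u := by
  have hd : Differentiable ℝ ψ := hψ.differentiable (by simp)
  have hd' : Continuous (fderiv ℝ ψ) := hψ.continuous_fderiv (by simp)
  obtain ⟨K, hK⟩ := hd'.bounded_above_of_compact_support (hc.fderiv ℝ)
  have hψc := hψ.continuous
  have hderiv : ∀ τ : ℝ, HasDerivAt (fun τ : ℝ => ∫ x, u x * ψ (x - τ • h))
      (∫ x, u x * fderiv ℝ ψ (x - τ • h) (-h)) τ := by
    intro τ
    refine (hasDerivAt_integral_of_dominated_loc_of_deriv_le (s := univ)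
      (F := fun (τ : ℝ) x => u x * ψ (x - τ • h))
      (F' := fun (τ : ℝ) x => u x * fderiv ℝ ψ (x - τ • h) (-h))
      (bound := fun x => |u x| * (K * ‖h‖)) Filter.univ_mem
      (Filter.Eventually.of_forall fun σ => ?_) ?_ ?_
      (Filter.Eventually.of_forall fun x σ _ => ?_) (hu.1.abs.mul_const _)
      (Filter.Eventually.of_forall fun x σ _ => ?_)).2
    · exact hu.1.aestronglyMeasurable.mul
        (by fun_prop : Continuous fun x => ψ (x - σ • h)).aestronglyMeasurable
    · exact hu.1.mul_bdd (c := 1)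
        (by fun_prop : Continuous fun x => ψ (x - τ • h)).aestronglyMeasurable
        (Filter.Eventually.of_forall fun x => h1 _)
    · exact hu.1.aestronglyMeasurable.mul
        (by fun_prop : Continuous fun x => fderiv ℝ ψ (x - τ • h) (-h)).aestronglyMeasurable
    · rw [norm_mul, Real.norm_eq_abs]
      gcongr
      refine (ContinuousLinearMap.le_opNorm _ _).trans ?_
      rw [norm_neg]
      gcongr
      exact hK _
    · have hin : HasDerivAt (fun σ : ℝ => x - σ • h) (-h) σ := by
        simpa using ((hasDerivAt_id σ).smul_const h).const_sub x
      exact ((hd _).hasFDerivAt.comp_hasDerivAt σ hin).const_mul (u x)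
  have hle : ∀ τ : ℝ, deriv (fun τ : ℝ => ∫ x, u x * ψ (x - τ • h)) τ ≤ ‖h‖ * totalVar u := by
    intro τ
    rw [(hderiv τ).deriv]
    have := integral_mul_fderiv_le hu.2 (ψ := fun x => ψ (x - τ • h))
      (hψ.comp (contDiff_id.sub contDiff_const))
      (hc.comp_homeomorph (Homeomorph.subRight (τ • h))) (fun x => h1 _) (-h)
    simpa [fderiv_comp_sub] using this
  have := image_sub_le_mul_sub_of_deriv_le (fun τ => (hderiv τ).differentiableAt) hle
    (zero_le_one' ℝ)
  simpa using this

/-- The `L¹` modulus of continuity of a function of bounded variation. -/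
theorem integral_abs_translate_sub_le {n : ℕ} {u : EuclideanSpace ℝ (Fin n) → ℝ} (hu : IsBV u)
    (h : EuclideanSpace ℝ (Fin n)) :
    ∫ x, |u (x + h) - u x| ≤ ‖h‖ * totalVar u := by
  have huh : Integrable fun x => u (x + h) := hu.1.comp_add_right h
  refine integral_abs_le_of_forall_test (huh.sub hu.1) fun ψ hψ hc h1 => ?_
  have hψb : ∀ᵐ x, ‖ψ x‖ ≤ 1 := Filter.Eventually.of_forall h1
  have hψm : AEStronglyMeasurable ψ := hψ.continuous.aestronglyMeasurable
  have i1 : Integrable fun x => u (x + h) * ψ x := huh.mul_bdd hψm hψb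
  have i2 : Integrable fun x => u x * ψ x := hu.1.mul_bdd hψm hψb
  have e : ∫ x, u (x + h) * ψ x = ∫ x, u x * ψ (x - h) := by
    rw [← integral_add_right_eq_self (fun x => u x * ψ (x - h)) h]
    simp
  simp only [Pi.sub_apply, sub_mul]
  rw [integral_sub i1 i2, e]
  exact integral_mul_comp_sub_sub_le hu hψ hc h1 h

theorem lintegral_abs_sub_smul_sub_le {n : ℕ} {u : EuclideanSpace ℝ (Fin n) → ℝ} (hu : IsBV u)
    (a b : EuclideanSpace ℝ (Fin n)) :
    ∫⁻ x, ENNReal.ofReal |u (x - a) - u (x - b)| ≤ ENNReal.ofReal (‖b - a‖ * totalVar u) := by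
  have hi : Integrable fun x => |u (x - a) - u (x - b)| :=
    ((hu.1.comp_sub_right a).sub (hu.1.comp_sub_right b)).abs
  rw [← ofReal_integral_eq_lintegral_ofReal hi
    (Filter.Eventually.of_forall fun x => abs_nonneg _)]
  refine ENNReal.ofReal_le_ofReal ((le_of_eq ?_).trans (integral_abs_translate_sub_le hu (b - a)))
  rw [← integral_sub_right_eq_self (fun x => |u (x + (b - a)) - u x|) b]
  congr 1 with x
  congr 3
  abel

theorem integrable_exp_neg_mul_norm_sq {n : ℕ} {b : ℝ} (hb : 0 < b) :
    Integrable fun x : EuclideanSpace ℝ (Fin n) => exp (-b * ‖x‖ ^ 2) := by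
  have := (GaussianFourier.integrable_cexp_neg_mul_sq_norm_add (b := (b : ℂ)) (by simpa) 0
    (0 : EuclideanSpace ℝ (Fin n))).norm
  refine this.congr (Filter.Eventually.of_forall fun x => ?_)
  simp only [Complex.norm_exp]
  norm_cast
  simp

theorem integrable_norm_sq_mul_exp {n : ℕ} {b : ℝ} (hb : 0 < b) :
    Integrable fun x : EuclideanSpace ℝ (Fin n) => ‖x‖ ^ 2 * exp (-b * ‖x‖ ^ 2) := by
  refine ((integrable_exp_neg_mul_norm_sq (n := n) (half_pos hb)).const_mul (2 / b)).mono'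
    (by fun_prop : Continuous _).aestronglyMeasurable (Filter.Eventually.of_forall fun x => ?_)
  rw [Real.norm_of_nonneg (by positivity)]
  have h1 : ‖x‖ ^ 2 ≤ 2 / b * exp (b / 2 * ‖x‖ ^ 2) := by
    have := Real.add_one_le_exp (b / 2 * ‖x‖ ^ 2)
    rw [div_mul_eq_mul_div, le_div_iff₀ hb]
    nlinarith
  calc ‖x‖ ^ 2 * exp (-b * ‖x‖ ^ 2)
      ≤ 2 / b * exp (b / 2 * ‖x‖ ^ 2) * exp (-b * ‖x‖ ^ 2) := by gcongr
    _ = 2 / b * exp (-(b / 2) * ‖x‖ ^ 2) := by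
        rw [mul_assoc, ← Real.exp_add]; congr 2; ring

theorem gaussian_nonneg (n : ℕ) (x : EuclideanSpace ℝ (Fin n)) : 0 ≤ gaussian n x := by
  unfold gaussian; positivity

theorem continuous_gaussian (n : ℕ) : Continuous (gaussian n) := by
  unfold gaussian; fun_prop

theorem gaussian_eq (n : ℕ) (x : EuclideanSpace ℝ (Fin n)) :
    gaussian n x = (2 * π) ^ (-(n : ℝ) / 2) * exp (-(1 / 2) * ‖x‖ ^ 2) := by
  rw [gaussian]; congr 2; ring

theorem integrable_gaussian (n : ℕ) : Integrable (gaussian n) := by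
  simp only [funext (gaussian_eq n)]
  exact (integrable_exp_neg_mul_norm_sq (by norm_num)).const_mul _

theorem integrable_norm_mul_gaussian (n : ℕ) : Integrable fun x => ‖x‖ * gaussian n x := by
  have h2 : Integrable fun x => ‖x‖ ^ 2 * gaussian n x := by
    refine ((integrable_norm_sq_mul_exp (n := n) (b := 1 / 2) (by norm_num)).const_mul
      ((2 * π) ^ (-(n : ℝ) / 2))).congr (Filter.Eventually.of_forall fun x => ?_)
    simp only [gaussian_eq]; ring
  refine ((integrable_gaussian n).add h2).mono'
    (continuous_norm.mul (continuous_gaussian n)).aestronglyMeasurable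
    (Filter.Eventually.of_forall fun x => ?_)
  have h0 := gaussian_nonneg n x
  rw [Real.norm_of_nonneg (by positivity), Pi.add_apply]
  nlinarith [mul_nonneg (sq_nonneg (‖x‖ - 1)) h0, mul_nonneg (norm_nonneg x) h0]

theorem gaussianScaled_one (n : ℕ) (x : EuclideanSpace ℝ (Fin n)) :
    gaussianScaled n 1 x = gaussian n x := by
  simp [gaussianScaled]

theorem integrable_gaussianScaled (n : ℕ) {a : ℝ} (ha : a ≠ 0) :
    Integrable (gaussianScaled n a) :=
  ((integrable_comp_smul_iff volume (gaussian n) (inv_ne_zero ha)).2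
    (integrable_gaussian n)).const_mul _

theorem mollify_mul {n : ℕ} (u : EuclideanSpace ℝ (Fin n) → ℝ) {t a : ℝ} (ht : 0 < t) (ha : 0 < a)
    (x : EuclideanSpace ℝ (Fin n)) :
    mollify u (t * a) x = ∫ z, u (x - t • z) * gaussianScaled n a z := by
  have h := Measure.integral_comp_smul (volume : Measure (EuclideanSpace ℝ (Fin n)))
    (fun y => u (x - y) * gaussianScaled n (t * a) y) t
  have ht' : |(t ^ Module.finrank ℝ (EuclideanSpace ℝ (Fin n)))⁻¹| = t ^ (-(n : ℝ)) := by
    rw [finrank_euclideanSpace_fin, abs_of_pos (by positivity), Real.rpow_neg ht.le,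
      Real.rpow_natCast]
  have h0 : t ^ (-(n : ℝ)) ≠ 0 := (Real.rpow_pos_of_pos ht _).ne'
  rw [ht', smul_eq_mul] at h
  refine mul_left_cancel₀ h0 ?_
  rw [mollify, ← h, ← integral_const_mul]
  congr 1 with z
  rw [gaussianScaled, gaussianScaled, Real.mul_rpow ht.le ha.le, mul_inv, smul_smul,
    mul_right_comm t⁻¹, inv_mul_cancel₀ ht.ne', one_mul]
  ring

theorem mollify_eq {n : ℕ} (u : EuclideanSpace ℝ (Fin n) → ℝ) {t : ℝ} (ht : 0 < t)
    (x : EuclideanSpace ℝ (Fin n)) :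
    mollify u t x = ∫ z, u (x - t • z) * gaussian n z := by
  simpa [gaussianScaled_one] using mollify_mul u ht one_pos x

theorem quasiMeasurePreserving_sub_smul {n : ℕ} {t : ℝ} (ht : t ≠ 0)
    (x : EuclideanSpace ℝ (Fin n)) :
    Measure.QuasiMeasurePreserving (fun z => x - t • z) volume volume :=
  (quasiMeasurePreserving_sub_left_of_right_invariant volume x).comp
    (Measure.quasiMeasurePreserving_smul volume ht)

theorem integrable_comp_sub_smul_mul {n : ℕ} {u g : EuclideanSpace ℝ (Fin n) → ℝ}
    (hu : AEStronglyMeasurable u) (hb : ∀ x, |u x| ≤ 1) (hg : Integrable g) {t : ℝ} (ht : t ≠ 0)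
    (x : EuclideanSpace ℝ (Fin n)) : Integrable fun z => u (x - t • z) * g z :=
  hg.bdd_mul (c := 1)
    (hu.comp_quasiMeasurePreserving (quasiMeasurePreserving_sub_smul ht x))
    (Filter.Eventually.of_forall fun _ => hb _)

theorem aestronglyMeasurable_sub_smul {n : ℕ} {u : EuclideanSpace ℝ (Fin n) → ℝ}
    (hu : AEStronglyMeasurable u) (t : ℝ) :
    AEStronglyMeasurable (fun p : EuclideanSpace ℝ (Fin n) × EuclideanSpace ℝ (Fin n) =>
      u (p.1 - t • p.2)) (volume.prod volume) :=
  hu.comp_quasiMeasurePreserving <| QuasiMeasurePreserving.prod_of_left (by fun_prop) <|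
    Filter.Eventually.of_forall fun z =>
      (measurePreserving_sub_right volume (t • z)).quasiMeasurePreserving

/-- `t ↦ u_t` is Lipschitz with values in `L¹`. -/
theorem lintegral_abs_mollify_sub_le {n : ℕ} {u : EuclideanSpace ℝ (Fin n) → ℝ} (hu : IsBV u)
    (hb : ∀ x, |u x| ≤ 1) {s t : ℝ} (hs : 0 < s) (ht : 0 < t) :
    ∫⁻ x, ENNReal.ofReal |mollify u s x - mollify u t x| ≤
      ENNReal.ofReal (|s - t| * ((∫ z, ‖z‖ * gaussian n z) * totalVar u)) := by
  have hm := hu.1.aestronglyMeasurable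
  have hmeas : AEMeasurable (fun p : EuclideanSpace ℝ (Fin n) × EuclideanSpace ℝ (Fin n) =>
      ENNReal.ofReal (|u (p.1 - s • p.2) - u (p.1 - t • p.2)| * gaussian n p.2))
      (volume.prod volume) := by
    have h1 := (aestronglyMeasurable_sub_smul hm s).sub (aestronglyMeasurable_sub_smul hm t)
    exact (h1.aemeasurable.abs.mul
      ((continuous_gaussian n).comp continuous_snd).aemeasurable).ennreal_ofReal
  calc ∫⁻ x, ENNReal.ofReal |mollify u s x - mollify u t x|
      ≤ ∫⁻ x, ∫⁻ z, ENNReal.ofReal (|u (x - s • z) - u (x - t • z)| * gaussian n z) := by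
        refine lintegral_mono fun x => ?_
        have is := integrable_comp_sub_smul_mul hm hb (integrable_gaussian n) hs.ne' x
        have it := integrable_comp_sub_smul_mul hm hb (integrable_gaussian n) ht.ne' x
        have e : ∀ z, |u (x - s • z) - u (x - t • z)| * gaussian n z =
            |u (x - s • z) * gaussian n z - u (x - t • z) * gaussian n z| := fun z => by
          rw [← sub_mul, abs_mul, abs_of_nonneg (gaussian_nonneg n z)]
        simp only [e]
        rw [mollify_eq u hs, mollify_eq u ht, ← integral_sub is it]
        refine le_of_le_of_eq ?_ (ofReal_integral_eq_lintegral_ofReal (is.sub it).abs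
          (Filter.Eventually.of_forall fun _ => abs_nonneg _))
        exact ENNReal.ofReal_le_ofReal (abs_integral_le_integral_abs)
    _ = ∫⁻ z, ∫⁻ x, ENNReal.ofReal (|u (x - s • z) - u (x - t • z)| * gaussian n z) :=
        lintegral_lintegral_swap hmeas
    _ ≤ ∫⁻ z, ENNReal.ofReal (|s - t| * totalVar u * (‖z‖ * gaussian n z)) := by
        refine lintegral_mono fun z => ?_
        simp only [ENNReal.ofReal_mul (abs_nonneg _)]
        rw [lintegral_mul_const' _ _ ENNReal.ofReal_ne_top]
        refine (mul_le_mul_left (lintegral_abs_sub_smul_sub_le hu _ _) _).trans_eq ?_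
        rw [← ENNReal.ofReal_mul (mul_nonneg (norm_nonneg _) (totalVar_nonneg hu.2)), ← sub_smul,
          norm_smul, Real.norm_eq_abs, abs_sub_comm t s]
        congr 1; ring
    _ = ENNReal.ofReal (|s - t| * ((∫ z, ‖z‖ * gaussian n z) * totalVar u)) := by
        have h0 : ∀ z, 0 ≤ |s - t| * totalVar u * (‖z‖ * gaussian n z) := fun z =>
          mul_nonneg (mul_nonneg (abs_nonneg _) (totalVar_nonneg hu.2))
            (mul_nonneg (norm_nonneg _) (gaussian_nonneg n z))
        rw [← ofReal_integral_eq_lintegral_ofReal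
          ((integrable_norm_mul_gaussian n).const_mul _) (Filter.Eventually.of_forall h0),
          integral_const_mul]
        congr 1; ring

theorem aestronglyMeasurable_mollify {n : ℕ} {u : EuclideanSpace ℝ (Fin n) → ℝ}
    (hu : AEStronglyMeasurable u) {t : ℝ} (ht : 0 < t) :
    AEStronglyMeasurable (mollify u t) := by
  rw [funext (mollify_eq u ht)]
  exact ((aestronglyMeasurable_sub_smul hu t).mul
    ((continuous_gaussian n).comp continuous_snd).aestronglyMeasurable).integral_prod_right'

theorem lintegral_abs_deriv_mollify_le {n : ℕ} {u : EuclideanSpace ℝ (Fin n) → ℝ} (hu : IsBV u)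
    (hb : ∀ x, |u x| ≤ 1) {t : ℝ} (ht : 0 < t) :
    ∫⁻ x, ENNReal.ofReal |deriv (fun s => mollify u s x) t| ≤
      ENNReal.ofReal ((∫ z, ‖z‖ * gaussian n z) * totalVar u) := by
  set h : ℕ → ℝ := fun k => 1 / ((k : ℝ) + 1)
  have hpos : ∀ k, 0 < h k := fun k => by positivity
  have hlim : Filter.Tendsto h Filter.atTop (nhdsWithin 0 {0}ᶜ) :=
    tendsto_nhdsWithin_iff.2 ⟨tendsto_one_div_add_atTop_nhds_zero_nat,
      Filter.Eventually.of_forall fun k => (hpos k).ne'⟩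
  have hm := hu.1.aestronglyMeasurable
  calc ∫⁻ x, ENNReal.ofReal |deriv (fun s => mollify u s x) t|
      ≤ ∫⁻ x, Filter.liminf (fun k =>
          ENNReal.ofReal |(h k)⁻¹ • (mollify u (t + h k) x - mollify u t x)|) Filter.atTop := by
        refine lintegral_mono fun x => ?_
        by_cases hd : DifferentiableAt ℝ (fun s => mollify u s x) t
        · have := hd.hasDerivAt.tendsto_slope_zero.comp hlim
          exact ((ENNReal.continuous_ofReal.tendsto _).comp this.abs).liminf_eq.ge
        · simp [deriv_zero_of_not_differentiableAt hd]
    _ ≤ Filter.liminf (fun k => ∫⁻ x,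
          ENNReal.ofReal |(h k)⁻¹ • (mollify u (t + h k) x - mollify u t x)|) Filter.atTop :=
        lintegral_liminf_le' fun k =>
          (((aestronglyMeasurable_mollify hm (add_pos ht (hpos k))).sub
            (aestronglyMeasurable_mollify hm ht)).const_smul (h k)⁻¹).aemeasurable.abs.ennreal_ofReal
    _ ≤ Filter.liminf (fun _ : ℕ =>
          ENNReal.ofReal ((∫ z, ‖z‖ * gaussian n z) * totalVar u)) Filter.atTop := by
        refine Filter.liminf_le_liminf (Filter.Eventually.of_forall fun k => ?_)
        have hi := inv_pos.2 (hpos k)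
        simp only [smul_eq_mul, abs_mul, abs_of_pos hi, ENNReal.ofReal_mul hi.le]
        rw [lintegral_const_mul' _ _ ENNReal.ofReal_ne_top]
        refine (mul_le_mul_right
          (lintegral_abs_mollify_sub_le hu hb (add_pos ht (hpos k)) ht) _).trans_eq ?_
        rw [← ENNReal.ofReal_mul hi.le, add_sub_cancel_left, abs_of_pos (hpos k),
          inv_mul_cancel_left₀ (hpos k).ne']
    _ = ENNReal.ofReal ((∫ z, ‖z‖ * gaussian n z) * totalVar u) := Filter.liminf_const _

/-- Integrable majorant for the Lipschitz constant of `a ↦ γ_{n,a}(z)` near `a = 1`. -/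
theorem exists_integrable_gaussianScaled_sub_le (n : ℕ) :
    ∃ D : EuclideanSpace ℝ (Fin n) → ℝ, Integrable D ∧ (∀ z, 0 ≤ D z) ∧
      ∀ a : ℝ, 1 / 2 ≤ a → a ≤ 2 → ∀ z,
        |gaussianScaled n a z - gaussianScaled n 1 z| ≤ |a - 1| * D z := by
  set c : ℝ := (2 * π) ^ (-(n : ℝ) / 2) with hc
  have hc0 : 0 ≤ c := by positivity
  refine ⟨fun z => 2 * (c * (n * 2 ^ (n - 1) + 2 ^ (n + 1) * ‖z‖ ^ 2) *
    exp (-(1 / 8) * ‖z‖ ^ 2)), ?_, fun z => by positivity, fun a ha1 ha2 z => ?_⟩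
  · refine (((integrable_exp_neg_mul_norm_sq (n := n) (b := 1 / 8) (by norm_num)).const_mul
      (2 * c * (n * 2 ^ (n - 1)))).add ((integrable_norm_sq_mul_exp (n := n) (b := 1 / 8)
        (by norm_num)).const_mul (2 * c * 2 ^ (n + 1)))).congr
        (Filter.Eventually.of_forall fun z => ?_)
    simp only [Pi.add_apply]; ring
  · have ha : 0 < a := by linarith
    set k : ℝ → ℝ := fun b => c * (b ^ n * exp (-(1 / 2) * b ^ 2 * ‖z‖ ^ 2)) with hk
    have hG : ∀ b : ℝ, 0 < b → gaussianScaled n b z = k b⁻¹ := fun b hb0 => by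
      rw [gaussianScaled, gaussian_eq, ← hc, hk, norm_smul, Real.norm_eq_abs,
        abs_of_pos (inv_pos.2 hb0), Real.rpow_neg hb0.le, Real.rpow_natCast, ← inv_pow, mul_pow]
      ring_nf
    have hkd : ∀ b, HasDerivAt k (c * ((n * b ^ (n - 1) - b ^ (n + 1) * ‖z‖ ^ 2) *
        exp (-(1 / 2) * b ^ 2 * ‖z‖ ^ 2))) b := fun b => by
      have h1 : HasDerivAt (fun b : ℝ => -(1 / 2) * b ^ 2 * ‖z‖ ^ 2) (-b * ‖z‖ ^ 2) b := by
        convert! ((hasDerivAt_pow 2 b).const_mul (-(1 / 2) : ℝ)).mul_const (‖z‖ ^ 2) using 1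
        push_cast; ring
      convert! ((hasDerivAt_pow n b).mul h1.exp).const_mul c using 1
      ring
    have hbd : ∀ b ∈ Icc (1 / 2 : ℝ) 2,
        ‖c * ((n * b ^ (n - 1) - b ^ (n + 1) * ‖z‖ ^ 2) * exp (-(1 / 2) * b ^ 2 * ‖z‖ ^ 2))‖ ≤
          c * (n * 2 ^ (n - 1) + 2 ^ (n + 1) * ‖z‖ ^ 2) * exp (-(1 / 8) * ‖z‖ ^ 2) := by
      intro b hb
      have hb0 : 0 < b := by linarith [hb.1]
      rw [norm_mul, norm_mul, Real.norm_of_nonneg hc0, Real.norm_of_nonneg (exp_pos _).le,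
        mul_assoc c]
      gcongr
      · refine (norm_sub_le _ _).trans ?_
        rw [Real.norm_of_nonneg (by positivity), Real.norm_of_nonneg (by positivity)]
        gcongr
        exacts [hb.2, hb.2]
      · nlinarith [hb.1]
    have hai : a⁻¹ ∈ Icc (1 / 2 : ℝ) 2 := by
      constructor
      · rw [one_div]; exact inv_anti₀ ha ha2
      · rw [inv_le_comm₀ ha two_pos, ← one_div]; exact ha1
    have hlip := (convex_Icc (1 / 2 : ℝ) 2).norm_image_sub_le_of_norm_hasDerivWithin_le
      (fun b _ => (hkd b).hasDerivWithinAt) hbd (x := 1) (y := a⁻¹) (by norm_num) hai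
    rw [hG a ha, hG 1 one_pos, inv_one, ← Real.norm_eq_abs]
    refine hlip.trans ?_
    have hsub : ‖a⁻¹ - 1‖ ≤ 2 * |a - 1| := by
      have : a⁻¹ - 1 = -(a⁻¹ * (a - 1)) := by field_simp; ring
      rw [this, norm_neg, norm_mul, Real.norm_of_nonneg (by positivity), Real.norm_eq_abs]
      gcongr
      exact hai.2
    calc _ ≤ c * (n * 2 ^ (n - 1) + 2 ^ (n + 1) * ‖z‖ ^ 2) * exp (-(1 / 8) * ‖z‖ ^ 2) *
          (2 * |a - 1|) := by gcongr
      _ = _ := by ring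

theorem exists_abs_deriv_mollify_le (n : ℕ) :
    ∃ M : ℝ, 0 ≤ M ∧ ∀ u : EuclideanSpace ℝ (Fin n) → ℝ, AEStronglyMeasurable u →
      (∀ x, |u x| ≤ 1) → ∀ t : ℝ, 0 < t → ∀ x, |deriv (fun s => mollify u s x) t| ≤ M / t := by
  obtain ⟨D, hDi, hD0, hD⟩ := exists_integrable_gaussianScaled_sub_le n
  have hM : 0 ≤ ∫ z, D z := integral_nonneg hD0
  refine ⟨∫ z, D z, hM, fun u hu hb t ht x => ?_⟩
  refine norm_deriv_le_of_lip' (f := fun s => mollify u s x) (div_nonneg hM ht.le) ?_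
  filter_upwards [Icc_mem_nhds (a := t / 2) (b := 2 * t) (by linarith) (by linarith)] with s hs
  have ha1 : 1 / 2 ≤ s / t := by rw [le_div_iff₀ ht]; linarith [hs.1]
  have ha2 : s / t ≤ 2 := by rw [div_le_iff₀ ht]; exact hs.2
  have ha : 0 < s / t := by linarith
  have is := integrable_comp_sub_smul_mul hu hb (integrable_gaussianScaled n ha.ne') ht.ne' x
  have it := integrable_comp_sub_smul_mul hu hb (integrable_gaussianScaled n one_ne_zero) ht.ne' x
  have es := mollify_mul u ht ha x
  have et := mollify_mul u ht one_pos x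
  rw [mul_div_cancel₀ s ht.ne'] at es
  rw [mul_one] at et
  rw [es, et, ← integral_sub is it]
  calc _ ≤ ∫ z, |s / t - 1| * D z := by
        refine norm_integral_le_of_norm_le (hDi.const_mul _)
          (Filter.Eventually.of_forall fun z => ?_)
        rw [← mul_sub, norm_mul]
        exact (mul_le_of_le_one_left (norm_nonneg _) (hb _)).trans (hD _ ha1 ha2 z)
    _ = (∫ z, D z) / t * ‖s - t‖ := by
        rw [integral_const_mul, div_sub_one ht.ne', abs_div, abs_of_pos ht, Real.norm_eq_abs]
        ring

/-- For `u ∈ BV(ℝⁿ)` with `|u| ≤ 1` and `u_t = u ∗ γ_{n,t}`, for every `t > 0`: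
(i) `∫ |∂_t u_t| dx ≤ C ∫|∇u|`, (ii) `‖∂_t u_t‖_∞ ≤ C/t`, and consequently
(iii) `∫ |∂_t u_t|² dx ≤ (C/t) ∫|∇u|`, with `C` a dimensional constant. -/
theorem heat_flow_derivative_bounds {n : ℕ} :
    ∃ C : ℝ, 0 < C ∧ ∀ u : EuclideanSpace ℝ (Fin n) → ℝ,
      IsBV u → (∀ x, |u x| ≤ 1) → ∀ t : ℝ, 0 < t →
      (∫⁻ x, ENNReal.ofReal |deriv (fun s => mollify u s x) t|
          ≤ ENNReal.ofReal (C * totalVar u)) ∧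
      (∀ x, |deriv (fun s => mollify u s x) t| ≤ C / t) ∧
      (∫⁻ x, ENNReal.ofReal ((deriv (fun s => mollify u s x) t) ^ 2)
          ≤ ENNReal.ofReal ((C / t) * totalVar u)) := by
  obtain ⟨M, hM0, hM⟩ := exists_abs_deriv_mollify_le n
  set L : ℝ := ∫ z, ‖z‖ * gaussian n z
  have hL0 : 0 ≤ L := integral_nonneg fun z => mul_nonneg (norm_nonneg z) (gaussian_nonneg n z)
  have hML : 0 ≤ M * L := mul_nonneg hM0 hL0
  refine ⟨L + M + M * L + 1, by positivity, fun u hu hb t ht => ?_⟩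
  have hV := totalVar_nonneg hu.2
  have h1 := lintegral_abs_deriv_mollify_le hu hb ht
  have h2 := hM u hu.1.aestronglyMeasurable hb t ht
  refine ⟨h1.trans (ENNReal.ofReal_le_ofReal ?_), fun x => (h2 x).trans ?_, ?_⟩
  · gcongr; linarith
  · gcongr; linarith
  · calc ∫⁻ x, ENNReal.ofReal ((deriv (fun s => mollify u s x) t) ^ 2)
        ≤ ∫⁻ x, ENNReal.ofReal (M / t) * ENNReal.ofReal |deriv (fun s => mollify u s x) t| := by
          refine lintegral_mono fun x => ?_
          rw [← ENNReal.ofReal_mul (by positivity), ← sq_abs, sq]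
          exact ENNReal.ofReal_le_ofReal (mul_le_mul_of_nonneg_right (h2 x) (abs_nonneg _))
      _ ≤ ENNReal.ofReal (M / t) * ENNReal.ofReal (L * totalVar u) := by
          rw [lintegral_const_mul' _ _ ENNReal.ofReal_ne_top]
          gcongr
      _ ≤ ENNReal.ofReal ((L + M + M * L + 1) / t * totalVar u) := by
          rw [← ENNReal.ofReal_mul (by positivity), ← mul_assoc, div_mul_eq_mul_div]
          refine ENNReal.ofReal_le_ofReal ?_
          gcongr
          linarith
end
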